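/- Let (S, T, 𝒫) be a setting with 𝒫 = {P_1, …, P_k}, let c ≥ 0 be an integer, and let F ⊆ F_0 be 5c-jumping. Then there exists D ⊆ F that is c-jumping and 2c-separated. -/

import Mathlib

open SimpleGraph

/-- The distance in a graph `G` between two sets of vertices (`⊤` if no connecting walk). -/
noncomputable def eSetDist {V : Type*} (G : SimpleGraph V) (A B : Set V) : ℕ∞ :=
  sInf {n : ℕ∞ | ∃ (a b : V) (w : G.Walk a b), a ∈ A ∧ b ∈ B ∧ (w.length : ℕ∞) = n}

/-- A *setting* `(S, T, 𝒫)`: a graph `G`, disjoint sets `S, T` of vertices, and a family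
`𝒫 = {P 0, …, P (k-1)}` of `k` pairwise vertex-disjoint `S`–`T` paths, each with no
internal vertex in `S ∪ T`. -/
structure Setting (V : Type) [DecidableEq V] (k : ℕ) where
  G : SimpleGraph V
  S : Set V
  T : Set V
  disjST : Disjoint S T
  sv : Fin k → V
  tv : Fin k → V
  P : ∀ h : Fin k, G.Walk (sv h) (tv h)
  sv_mem : ∀ h, sv h ∈ S
  tv_mem : ∀ h, tv h ∈ T
  isPath : ∀ h, (P h).IsPath
  disjP : ∀ h h' : Fin k, h ≠ h' → ∀ x : V, x ∈ (P h).support → x ∉ (P h').support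
  internal : ∀ h : Fin k, ∀ x ∈ (P h).support, x ∈ S ∪ T → x = sv h ∨ x = tv h

namespace Setting

variable {V : Type} [DecidableEq V] {k : ℕ} (M : Setting V k)

/-- `V𝒫`, the set of vertices of the paths of the setting. -/
def VP : Set V := {x | ∃ h : Fin k, x ∈ (M.P h).support}

/-- `F₀`: ordered pairs of distinct vertices of `V𝒫 ∪ S ∪ T`. -/
def F0 : Set (V × V) :=
  {p | p.1 ≠ p.2 ∧ p.1 ∈ M.VP ∪ M.S ∪ M.T ∧ p.2 ∈ M.VP ∪ M.S ∪ M.T}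

/-- The position of a vertex along the path `P h` (used to express "earlier/later":
`u` is earlier than `v` in `P h` iff both lie on `P h` and `idx h u < idx h v`;
the subpath of `P h` between `u` and `v` has length `idx h v - idx h u`). -/
def idx (h : Fin k) (x : V) : ℕ := (M.P h).support.idxOf x

/-- A `c`-barrier, described by the two ends `α h`, `β h` of each subpath `Q h` of `P h`:
each `Q h` has length `idx h (β h) - idx h (α h) ≤ c`. -/
def IsBarrier (c : ℕ) (α β : Fin k → V) : Prop :=
  ∀ h : Fin k, α h ∈ (M.P h).support ∧ β h ∈ (M.P h).support ∧
    M.idx h (α h) ≤ M.idx h (β h) ∧ M.idx h (β h) - M.idx h (α h) ≤ c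

/-- Membership in the vertex set `V(Q 0 ∪ ⋯ ∪ Q (k-1))` of a barrier. -/
def InBarrier (α β : Fin k → V) (x : V) : Prop :=
  ∃ h : Fin k, x ∈ (M.P h).support ∧ M.idx h (α h) ≤ M.idx h x ∧ M.idx h x ≤ M.idx h (β h)

/-- The pair `p = (a, b)` jumps the barrier `(α, β)`. -/
def Jumps (α β : Fin k → V) (p : V × V) : Prop :=
  ¬ M.InBarrier α β p.1 ∧ ¬ M.InBarrier α β p.2 ∧
  (p.1 ∈ M.S \ M.VP ∨ ∃ h : Fin k, p.1 ∈ (M.P h).support ∧ M.idx h p.1 < M.idx h (α h)) ∧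
  (p.2 ∈ M.T \ M.VP ∨ ∃ h : Fin k, p.2 ∈ (M.P h).support ∧ M.idx h (β h) < M.idx h p.2)

/-- `F` is `c`-jumping: every `c`-barrier is jumped by some member of `F`. -/
def Jumping (c : ℕ) (F : Set (V × V)) : Prop :=
  ∀ α β : Fin k → V, M.IsBarrier c α β → ∃ p ∈ F, M.Jumps α β p

/-- `ab 0, …, ab (n-1)` is a `c`-augmenting sequence. -/
def IsAugSeq (c : ℕ) {n : ℕ} (ab : Fin n → V × V) : Prop :=
  ∃ hn : 0 < n,
    (∀ i, ab i ∈ M.F0) ∧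
    (ab ⟨0, hn⟩).1 ∈ M.S \ M.VP ∧
    (ab ⟨n - 1, Nat.sub_lt hn Nat.one_pos⟩).2 ∈ M.T \ M.VP ∧
    ∀ (i : ℕ) (hi : i + 1 < n), ∃ h : Fin k,
      (ab ⟨i, Nat.lt_of_succ_lt hi⟩).2 ∈ (M.P h).support ∧
      (ab ⟨i + 1, hi⟩).1 ∈ (M.P h).support ∧
      M.idx h (ab ⟨i + 1, hi⟩).1 < M.idx h (ab ⟨i, Nat.lt_of_succ_lt hi⟩).2 ∧
      c + 1 ≤ M.idx h (ab ⟨i, Nat.lt_of_succ_lt hi⟩).2 - M.idx h (ab ⟨i + 1, hi⟩).1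

/-- `U𝒫`, the union `P 0 ∪ ⋯ ∪ P (k-1)` as a graph on `V`. -/
def UP : SimpleGraph V := ⨆ h : Fin k, ((M.P h).toSubgraph).spanningCoe

open Classical in
/-- `dist_{U𝒫}(u, v)`: the distance between `u` and `v` in `U𝒫`, taken to be `⊤` if `u`
or `v` is not in `V𝒫` or they lie in different components of `U𝒫`. -/
noncomputable def pdist (u v : V) : ℕ∞ :=
  if u ∈ M.VP ∧ v ∈ M.VP then eSetDist M.UP {u} {v} else ⊤

/-- `D` is `ℓ`-separated. -/
def Separated (ℓ : ℕ) (D : Set (V × V)) : Prop :=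
  ∀ p ∈ D, ∀ q ∈ D, p ≠ q →
    (ℓ : ℕ∞) < M.pdist p.1 q.1 ∧ (ℓ : ℕ∞) < M.pdist p.2 q.2

end Setting

namespace Setting

/-- One step inside `F`. -/
def StepIn {X : Type} (E : X → X → Prop) (F : Set X) (p q : X) : Prop :=
  p ∈ F ∧ q ∈ F ∧ E p q

lemma StepIn.mono {X : Type} {E : X → X → Prop} {F F' : Set X} (h : F ⊆ F') {p q : X}
    (hs : Relation.ReflTransGen (StepIn E F) p q) : Relation.ReflTransGen (StepIn E F') p q :=
  Relation.ReflTransGen.mono (fun _ _ ⟨a, b, c⟩ => ⟨h a, h b, c⟩) _ _ hs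

/-- Net extraction along a path. -/
lemma net_aux {X : Type} (E E' near : X → X → Prop) (hsymm : ∀ p q, near p q → near q p)
    (hE : ∀ p q, E p q → E' p q) (hE' : ∀ p q r, E p q → near q r → E' p r)
    (F : Set X) (s t : X) (ht : t ∈ F) (hp : Relation.ReflTransGen (StepIn E F) s t) :
    ∃ N ⊆ F, (∀ p ∈ N, ∀ q ∈ N, p ≠ q → ¬ near p q) ∧
      (∀ p ∈ N, Relation.ReflTransGen (StepIn E' N) p t) ∧ t ∈ N ∧
      ∃ r ∈ N, s = r ∨ near s r := by
  induction hp using Relation.ReflTransGen.head_induction_on with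
  | refl =>
    refine ⟨{t}, by simpa using ht, ?_, ?_, rfl, t, rfl, Or.inl rfl⟩
    · rintro p rfl q rfl h; exact absurd rfl h
    · rintro p rfl; exact .refl
  | @head a b h' _ ih =>
    obtain ⟨N, hNF, hsep, hreach, htN, r, hr, hbr⟩ := ih
    by_cases hex : ∃ r ∈ N, a = r ∨ near a r
    · exact ⟨N, hNF, hsep, hreach, htN, hex⟩
    · push Not at hex
      refine ⟨insert a N, Set.insert_subset h'.1 hNF, ?_, ?_, Set.mem_insert_of_mem _ htN,
        a, Set.mem_insert _ _, Or.inl rfl⟩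
      · rintro p (rfl | hp) q (rfl | hq) hne
        · exact absurd rfl hne
        · exact (hex q hq).2
        · exact fun h => (hex p hp).2 (hsymm _ _ h)
        · exact hsep p hp q hq hne
      · rintro p (rfl | hp)
        · refine Relation.ReflTransGen.head ⟨Set.mem_insert _ _, Set.mem_insert_of_mem _ hr, ?_⟩
            (StepIn.mono (Set.subset_insert _ _) (hreach r hr))
          rcases hbr with rfl | hbr
          · exact hE _ _ h'.2.2
          · exact hE' _ _ _ h'.2.2 hbr
        · exact StepIn.mono (Set.subset_insert _ _) (hreach p hp)

lemma net {X : Type} (E E' near : X → X → Prop) (hsymm : ∀ p q, near p q → near q p)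
    (hE : ∀ p q, E p q → E' p q) (hE' : ∀ p q r, E p q → near q r → E' p r)
    (F : Set X) (s t : X) (ht : t ∈ F) (hs : ∀ r, ¬ near s r)
    (hp : Relation.ReflTransGen (StepIn E F) s t) :
    ∃ N ⊆ F, (∀ p ∈ N, ∀ q ∈ N, p ≠ q → ¬ near p q) ∧ s ∈ N ∧ t ∈ N ∧
      Relation.ReflTransGen (StepIn E' N) s t := by
  obtain ⟨N, h1, h2, h3, h4, r, hr, h5⟩ := net_aux E E' near hsymm hE hE' F s t ht hp
  rcases h5 with rfl | h5
  · exact ⟨N, h1, h2, hr, h4, h3 _ hr⟩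
  · exact absurd h5 (hs r)

variable {V : Type} [DecidableEq V] {k : ℕ} (M : Setting V k)

/-- The step relation of augmenting sequences. -/
def Gap (m : ℕ) (p q : V × V) : Prop :=
  ∃ h, p.2 ∈ (M.P h).support ∧ q.1 ∈ (M.P h).support ∧ M.idx h q.1 + m < M.idx h p.2

/-- Closeness along a common path. -/
def Near (l : ℕ) (u v : V) : Prop :=
  ∃ h, u ∈ (M.P h).support ∧ v ∈ (M.P h).support ∧
    M.idx h u ≤ M.idx h v + l ∧ M.idx h v ≤ M.idx h u + l

lemma path_unique {h h' : Fin k} {x : V} (hx : x ∈ (M.P h).support)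
    (hx' : x ∈ (M.P h').support) : h = h' := by
  by_contra hne
  exact M.disjP h h' hne x hx hx'

lemma idx_getVert (h : Fin k) (i : ℕ) (hi : i ≤ (M.P h).length) :
    M.idx h ((M.P h).getVert i) = i := by
  have hl : i < (M.P h).support.length := by
    rw [SimpleGraph.Walk.length_support]; omega
  have := List.Nodup.idxOf_getElem (M.isPath h).support_nodup i hl
  rw [SimpleGraph.Walk.support_getElem_eq_getVert] at this
  exact this

lemma idx_le (h : Fin k) {x : V} (hx : x ∈ (M.P h).support) : M.idx h x ≤ (M.P h).length := by
  have := List.idxOf_lt_length_of_mem hx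
  rw [SimpleGraph.Walk.length_support] at this
  unfold idx; omega

lemma jumping_of_path (m : ℕ) (D : Set (V × V)) (s t : V × V) (hs : s.1 ∈ M.S \ M.VP)
    (ht : t.2 ∈ M.T \ M.VP) (htD : t ∈ D)
    (hp : Relation.ReflTransGen (StepIn (M.Gap m) D) s t) : M.Jumping m D := by
  intro α β hb
  by_contra hno
  push Not at hno
  have key : ∀ p : V × V,
      (p.1 ∈ M.S \ M.VP ∨ ∃ h : Fin k, p.1 ∈ (M.P h).support ∧ M.idx h p.1 < M.idx h (α h)) →
      (p.2 ∈ M.T \ M.VP ∨ ∃ h : Fin k, p.2 ∈ (M.P h).support ∧ M.idx h (β h) < M.idx h p.2) →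
      p ∉ D := by
    intro p h1 h2 hpD
    refine hno p hpD ⟨?_, ?_, h1, h2⟩
    · rintro ⟨h, hx, hx1, hx2⟩
      rcases h1 with h1 | ⟨h', hx', hlt⟩
      · exact h1.2 ⟨h, hx⟩
      · obtain rfl := M.path_unique hx hx'
        omega
    · rintro ⟨h, hx, hx1, hx2⟩
      rcases h2 with h1 | ⟨h', hx', hlt⟩
      · exact h1.2 ⟨h, hx⟩
      · obtain rfl := M.path_unique hx hx'
        omega
  have inv : t.1 ∈ M.S \ M.VP ∨
      ∃ h : Fin k, t.1 ∈ (M.P h).support ∧ M.idx h t.1 < M.idx h (α h) := by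
    clear ht htD
    induction hp with
    | refl => exact Or.inl hs
    | tail _ hstep ih =>
      obtain ⟨hbD, _, h, hx, hy, hlt⟩ := hstep
      refine Or.inr ⟨h, hy, ?_⟩
      by_contra hcon
      refine key _ ih (Or.inr ⟨h, hx, ?_⟩) hbD
      have := hb h
      omega
  exact key t inv (Or.inl ht) htD

lemma path_of_jumping [Fintype V] (m : ℕ) (F : Set (V × V)) (hj : M.Jumping m F) :
    ∃ s t, s ∈ F ∧ t ∈ F ∧ s.1 ∈ M.S \ M.VP ∧ t.2 ∈ M.T \ M.VP ∧
      Relation.ReflTransGen (StepIn (M.Gap m) F) s t := by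
  by_contra hno
  push Not at hno
  let R : Set (V × V) := {p | p ∈ F ∧ ∃ s ∈ F, s.1 ∈ M.S \ M.VP ∧
    Relation.ReflTransGen (StepIn (M.Gap m) F) s p}
  have hch : ∀ h : Fin k, ∃ α β : V, α ∈ (M.P h).support ∧ β ∈ (M.P h).support ∧
      M.idx h α = M.idx h β - m ∧
      (∀ p ∈ R, p.2 ∈ (M.P h).support → M.idx h p.2 ≤ M.idx h β) ∧
      (M.idx h β = 0 ∨ ∃ q ∈ R, q.2 = β) := by
    intro h
    have hβ : ∃ β : V, β ∈ (M.P h).support ∧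
        (∀ p ∈ R, p.2 ∈ (M.P h).support → M.idx h p.2 ≤ M.idx h β) ∧
        (M.idx h β = 0 ∨ ∃ q ∈ R, q.2 = β) := by
      by_cases hne : {p | p ∈ R ∧ p.2 ∈ (M.P h).support}.Nonempty
      · obtain ⟨q, hq, hmax⟩ := Set.exists_max_image _ (fun p : V × V => M.idx h p.2)
          (Set.toFinite {p | p ∈ R ∧ p.2 ∈ (M.P h).support}) hne
        exact ⟨q.2, hq.2, fun p hp hp2 => hmax p ⟨hp, hp2⟩, Or.inr ⟨q, hq.1, rfl⟩⟩
      · refine ⟨M.sv h, (M.P h).start_mem_support, fun p hp hp2 => absurd ⟨p, hp, hp2⟩ hne,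
          Or.inl ?_⟩
        have := M.idx_getVert h 0 (Nat.zero_le _)
        rwa [SimpleGraph.Walk.getVert_zero] at this
    obtain ⟨β, h1, h2, h3⟩ := hβ
    refine ⟨(M.P h).getVert (M.idx h β - m), β, SimpleGraph.Walk.getVert_mem_support _ _, h1,
      ?_, h2, h3⟩
    have := M.idx_le h h1
    exact M.idx_getVert h _ (by omega)
  choose α β hα hβ hαβ hmax hatt using hch
  obtain ⟨p, hpF, -, -, h1, h2⟩ := hj α β (fun h => ⟨hα h, hβ h, by
    have := hαβ h; omega, by have := hαβ h; omega⟩)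
  have hpR : p ∈ R := by
    rcases h1 with h1 | ⟨h, hx, hlt⟩
    · exact ⟨hpF, p, hpF, h1, .refl⟩
    · have := hαβ h
      rcases hatt h with h0 | ⟨q, ⟨hqF, s, hsF, hs, hpath⟩, hq⟩
      · omega
      · refine ⟨hpF, s, hsF, hs, hpath.tail ⟨hqF, hpF, h, ?_, hx, ?_⟩⟩
        · rw [hq]; exact hβ h
        · rw [hq]; omega
  rcases h2 with h2 | ⟨h, hx, hlt⟩
  · obtain ⟨_, s, hsF, hs, hpath⟩ := hpR
    exact hno s p hsF hpF hs h2 hpath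
  · have := hmax h p hpR hx
    omega

lemma UP_adj {u v : V} (hadj : M.UP.Adj u v) (h : Fin k) (hu : u ∈ (M.P h).support) :
    v ∈ (M.P h).support ∧ M.idx h u ≤ M.idx h v + 1 ∧ M.idx h v ≤ M.idx h u + 1 := by
  unfold UP at hadj
  rw [SimpleGraph.iSup_adj] at hadj
  obtain ⟨h', hadj⟩ := hadj
  rw [SimpleGraph.Subgraph.spanningCoe_adj] at hadj
  have hu' : u ∈ (M.P h').support := by
    simpa using hadj.fst_mem
  have hv' : v ∈ (M.P h').support := by
    simpa using hadj.snd_mem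
  obtain rfl := M.path_unique hu hu'
  refine ⟨hv', ?_⟩
  rw [SimpleGraph.Walk.toSubgraph_adj_iff] at hadj
  obtain ⟨i, hi, hlt⟩ := hadj
  have e1 := M.idx_getVert h i hlt.le
  have e2 := M.idx_getVert h (i + 1) hlt
  rw [Sym2.eq_iff] at hi
  rcases hi with ⟨rfl, rfl⟩ | ⟨rfl, rfl⟩ <;> omega

lemma UP_walk {u v : V} (w : M.UP.Walk u v) (h : Fin k) (hu : u ∈ (M.P h).support) :
    v ∈ (M.P h).support ∧ M.idx h u ≤ M.idx h v + w.length ∧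
      M.idx h v ≤ M.idx h u + w.length := by
  induction w with
  | nil => exact ⟨hu, by simp, by simp⟩
  | cons hadj w ih =>
    have h1 := M.UP_adj hadj h hu
    have h2 := ih h1.1
    rw [SimpleGraph.Walk.length_cons]
    refine ⟨h2.1, ?_, ?_⟩ <;> omega

lemma lt_pdist (l : ℕ) (u v : V) (hn : ¬ M.Near l u v) : (l : ℕ∞) < M.pdist u v := by
  unfold pdist
  split_ifs with hm
  · refine lt_of_lt_of_le (b := ((l + 1 : ℕ) : ℕ∞)) (by exact_mod_cast Nat.lt_succ_self l) ?_
    refine le_sInf ?_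
    rintro n ⟨a, b, w, rfl, rfl, rfl⟩
    by_contra hlt
    have hlt' : w.length < l + 1 := by
      rw [not_le] at hlt; exact_mod_cast hlt
    obtain ⟨h, hu⟩ := hm.1
    have := M.UP_walk w h hu
    exact hn ⟨h, hu, this.1, by omega, by omega⟩
  · exact ENat.natCast_lt_top l

lemma Near.symm {l : ℕ} {u v : V} (h : M.Near l u v) : M.Near l v u := by
  obtain ⟨h, a, b, c, d⟩ := h
  exact ⟨h, b, a, d, c⟩

end Setting

/-- From a `5c`-jumping set one can extract a `c`-jumping, `2c`-separated subset. -/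
theorem separate_all (V : Type) [Fintype V] [DecidableEq V] (k : ℕ)
    (M : Setting V k) (c : ℕ) (F : Set (V × V)) (hF : F ⊆ M.F0)
    (hjump : M.Jumping (5 * c) F) :
    ∃ D ⊆ F, M.Jumping c D ∧ M.Separated (2 * c) D := by
  obtain ⟨s, t, hsF, htF, hs, ht, hp⟩ := M.path_of_jumping _ F hjump
  obtain ⟨N, hNF, hNsep, hsN, htN, hpN⟩ := Setting.net (M.Gap (5 * c)) (M.Gap (3 * c))
    (fun p q => M.Near (2 * c) p.1 q.1) (fun _ _ h => Setting.Near.symm M h)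
    (by rintro p q ⟨h, h1, h2, h3⟩; exact ⟨h, h1, h2, by omega⟩)
    (by
      rintro p q r ⟨h, h1, h2, h3⟩ ⟨h', g1, g2, g3, g4⟩
      obtain rfl := M.path_unique h2 g1
      exact ⟨h, h1, g2, by omega⟩)
    F s t htF (fun r ⟨h, h1, _⟩ => hs.2 ⟨h, h1⟩) hp
  have hpN' : Relation.ReflTransGen
      (Setting.StepIn (fun p q => M.Gap (3 * c) q p) N) t s := by
    refine Relation.ReflTransGen.mono ?_ _ _ (Relation.ReflTransGen.swap _ _ hpN)
    rintro a b ⟨h1, h2, h3⟩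
    exact ⟨h2, h1, h3⟩
  obtain ⟨D, hDN, hDsep, htD, hsD, hpD⟩ := Setting.net (fun p q => M.Gap (3 * c) q p)
    (fun p q => M.Gap c q p)
    (fun p q => M.Near (2 * c) p.2 q.2) (fun _ _ h => Setting.Near.symm M h)
    (by rintro p q ⟨h, h1, h2, h3⟩; exact ⟨h, h1, h2, by omega⟩)
    (by
      rintro p q r ⟨h, h1, h2, h3⟩ ⟨h', g1, g2, g3, g4⟩
      obtain rfl := M.path_unique h1 g1
      exact ⟨h, g2, h2, by omega⟩)
    N t s hsN (fun r ⟨h, h1, _⟩ => ht.2 ⟨h, h1⟩) hpN'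
  have hpD' : Relation.ReflTransGen (Setting.StepIn (M.Gap c) D) s t := by
    refine Relation.ReflTransGen.mono ?_ _ _ (Relation.ReflTransGen.swap _ _ hpD)
    rintro a b ⟨h1, h2, h3⟩
    exact ⟨h2, h1, h3⟩
  refine ⟨D, hDN.trans hNF, M.jumping_of_path c D s t hs ht htD hpD', ?_⟩
  intro p hp q hq hne
  exact ⟨M.lt_pdist _ _ _ (hNsep p (hDN hp) q (hDN hq) hne),
    M.lt_pdist _ _ _ (hDsep p hp q hq hne)⟩
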